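/- arXiv:1003.0980 — 4 statements merged into one kernel-verified Lean document; each statement's English description precedes it below -/
import Mathlib

section
/- Let l > 0 and define B(l) = (1/2)·log(1 + 2/(eˡ − 1)). If b ≥ 0 is a real number satisfying cosh b ≥ coth(l/2), then b/2 ≥ B(l). -/
theorem Real.cosh_half_div_sinh_half {l : ℝ} (hl : 0 < l) :
    Real.cosh (l / 2) / Real.sinh (l / 2) = 1 + 2 / (Real.exp l - 1) := by
  have hs : Real.sinh (l / 2) ≠ 0 := (Real.sinh_pos_iff.2 (half_pos hl)).ne'
  have he : Real.exp l - 1 ≠ 0 := (sub_pos.2 (Real.one_lt_exp_iff.2 hl)).ne'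
  have hsq : Real.exp l = Real.exp (l / 2) * Real.exp (l / 2) := by
    rw [← Real.exp_add, add_halves]
  have hinv : Real.exp (l / 2) * Real.exp (-(l / 2)) = 1 := by
    rw [← Real.exp_add, add_neg_cancel, Real.exp_zero]
  rw [one_add_div he, div_eq_div_iff hs he, Real.cosh_eq, Real.sinh_eq, hsq]
  linear_combination Real.exp (l / 2) * hinv

theorem Real.cosh_le_exp_of_nonneg {b : ℝ} (hb : 0 ≤ b) : Real.cosh b ≤ Real.exp b := by
  rw [← Real.cosh_add_sinh]
  exact le_add_of_nonneg_right (Real.sinh_nonneg_iff.2 hb)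

/-- If `cosh b ≥ coth (l/2)` with `b ≥ 0`, `l > 0`, then `b/2 ≥ B(l)` where
`B(l) = (1/2) log (1 + 2/(e^l - 1))` is the collar-width function. -/
theorem stmt2 (l b : ℝ) (hl : 0 < l) (hb : 0 ≤ b)
    (h : Real.cosh b ≥ Real.cosh (l / 2) / Real.sinh (l / 2)) :
    b / 2 ≥ (1 / 2) * Real.log (1 + 2 / (Real.exp l - 1)) := by
  rw [Real.cosh_half_div_sinh_half hl] at h
  have he : 0 < Real.exp l - 1 := sub_pos.2 (Real.one_lt_exp_iff.2 hl)
  have hlog : Real.log (1 + 2 / (Real.exp l - 1)) ≤ b :=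
    (Real.log_le_iff_le_exp (by positivity)).2 (h.le.trans (Real.cosh_le_exp_of_nonneg hb))
  linarith
end

section
/- Let l > 0 and define B(l) = (1/2)·log(1 + 2/(eˡ − 1)). If h ≥ 0 is a real number satisfying cosh²h ≥ 1 + 2·coth(l/2)/sinh(l/2), then h ≥ B(l). -/
/-- If `cosh² h ≥ 1 + 2 coth(l/2)/sinh(l/2)` with `h ≥ 0`, `l > 0`, then `h ≥ B(l)` where
`B(l) = (1/2) log (1 + 2/(e^l - 1))` is the collar-width function. -/
theorem stmt3 (l h : ℝ) (hl : 0 < l) (hh : 0 ≤ h)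
    (hch : Real.cosh h ^ 2 ≥
      1 + 2 * (Real.cosh (l / 2) / Real.sinh (l / 2)) / Real.sinh (l / 2)) :
    h ≥ (1 / 2) * Real.log (1 + 2 / (Real.exp l - 1)) := by
  have hs : 0 < Real.sinh (l / 2) := Real.sinh_pos_iff.mpr (half_pos hl)
  have hc : 1 ≤ Real.cosh (l / 2) := Real.one_le_cosh _
  have hexp : Real.exp l - 1
      = 2 * (Real.cosh (l / 2) + Real.sinh (l / 2)) * Real.sinh (l / 2) := by
    have hsq : Real.exp l = (Real.cosh (l / 2) + Real.sinh (l / 2)) ^ 2 := by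
      rw [Real.cosh_add_sinh, ← Real.exp_nat_mul]
      congr 1
      push_cast
      ring
    rw [hsq]
    linear_combination Real.cosh_sq_sub_sinh_sq (l / 2)
  have hcosh : Real.cosh h ≤ Real.exp h := by
    rw [← Real.cosh_add_sinh]
    exact le_add_of_nonneg_right (Real.sinh_nonneg_iff.mpr hh)
  have hsq : Real.cosh h ^ 2 ≤ Real.exp (2 * h) := by
    rw [two_mul, Real.exp_add, ← sq]
    exact pow_le_pow_left₀ (Real.cosh_pos h).le hcosh 2
  have hfrac : 2 / (Real.exp l - 1)
      ≤ 2 * (Real.cosh (l / 2) / Real.sinh (l / 2)) / Real.sinh (l / 2) := by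
    rw [hexp, mul_div_assoc', div_div, div_le_div_iff₀ (by positivity) (by positivity)]
    have hlt : Real.sinh (l / 2) < Real.cosh (l / 2) := Real.sinh_lt_cosh _
    nlinarith [mul_pos hs (sub_pos.mpr hlt), mul_le_mul_of_nonneg_left hc hs.le,
      mul_nonneg hs.le (mul_nonneg (sub_nonneg.mpr hc) (hs.trans hlt).le),
      mul_nonneg hs.le (mul_nonneg (sub_nonneg.mpr hc) hs.le)]
  have hden : 0 < Real.exp l - 1 := by
    rw [hexp]
    positivity
  have hlog : Real.log (1 + 2 / (Real.exp l - 1)) ≤ 2 * h :=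
    (Real.log_le_iff_le_exp (by positivity)).mpr (by linarith)
  linarith
end

section
/- In the hyperbolic upper half-plane, let G = {w : Re w = 0} be the positive imaginary axis (a complete geodesic). For every point z with arg z = π/2 + ε·θ, where ε = ±1 and 0 ≤ θ < π/2, the infimum of hyperbolic distances from z to points of G equals log((1 + sin θ)/cos θ). Consequently, for ω ≥ 0, the set {z : dist(z, G) ≤ ω} coincides with the Euclidean sector {z : π/2 − θ(ω) ≤ arg z ≤ π/2 + θ(ω)} where θ(ω) = 2·arctan((e^ω − 1)/(e^ω + 1)). -/
open Real

/-- The distance to the imaginary axis is the distance to the point of the axis with the same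
Euclidean norm. -/
theorem UpperHalfPlane.infDist_imaginaryAxis {z : UpperHalfPlane} {d : ℝ} (hd : 0 ≤ d)
    (h : Real.cosh d = ‖(z : ℂ)‖ / z.im) :
    Metric.infDist z {w : UpperHalfPlane | (w : ℂ).re = 0} = d := by
  have hz : (z : ℂ) ≠ 0 := z.ne_zero
  have hn : 0 < ‖(z : ℂ)‖ := norm_pos_iff.mpr hz
  have hsq : z.re ^ 2 + z.im ^ 2 = ‖(z : ℂ)‖ ^ 2 := by
    rw [← Complex.normSq_eq_norm_sq, Complex.normSq_apply, UpperHalfPlane.coe_re,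
      UpperHalfPlane.coe_im]
    ring
  have hzi := z.im_pos
  have key : ∀ w : UpperHalfPlane, (w : ℂ).re = 0 →
      Real.cosh (dist z w) = (‖(z : ℂ)‖ ^ 2 + w.im ^ 2) / (2 * z.im * w.im) := by
    intro w hw
    rw [UpperHalfPlane.coe_re] at hw
    rw [UpperHalfPlane.cosh_dist', hw, sub_zero, hsq]
  let w₀ : UpperHalfPlane := ⟨⟨0, ‖(z : ℂ)‖⟩, hn⟩
  have hw₀ : w₀ ∈ {w : UpperHalfPlane | (w : ℂ).re = 0} := rfl
  have him : w₀.im = ‖(z : ℂ)‖ := rfl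
  apply le_antisymm
  · refine (Metric.infDist_le_dist_of_mem hw₀).trans ?_
    rw [← abs_of_nonneg hd, ← abs_of_nonneg (dist_nonneg (x := z) (y := w₀)),
      ← Real.cosh_le_cosh, key w₀ hw₀, h, him]
    apply le_of_eq
    field_simp
    ring
  · refine (Metric.le_infDist ⟨w₀, hw₀⟩).mpr fun {w} hw => ?_
    have hwi := w.im_pos
    rw [← abs_of_nonneg hd, ← abs_of_nonneg (dist_nonneg (x := z) (y := w)),
      ← Real.cosh_le_cosh, key w hw, h, div_le_div_iff₀ hzi (by positivity)]
    nlinarith [mul_nonneg hzi.le (sq_nonneg (‖(z : ℂ)‖ - w.im))]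

/-- The distance to the imaginary axis in terms of the angle with the axis. -/
theorem UpperHalfPlane.infDist_imaginaryAxis_of_arg {z : UpperHalfPlane} {ε θ : ℝ}
    (hε : ε = 1 ∨ ε = -1) (h0 : 0 ≤ θ) (h1 : θ < π / 2)
    (harg : Complex.arg (z : ℂ) = π / 2 + ε * θ) :
    Metric.infDist z {w : UpperHalfPlane | (w : ℂ).re = 0} =
      Real.log ((1 + Real.sin θ) / Real.cos θ) := by
  have hc : 0 < Real.cos θ := Real.cos_pos_of_mem_Ioo ⟨by linarith, h1⟩
  have hs : 0 ≤ Real.sin θ := Real.sin_nonneg_of_nonneg_of_le_pi h0 (by linarith)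
  have hsc := Real.sin_sq_add_cos_sq θ
  have hn : 0 < ‖(z : ℂ)‖ := norm_pos_iff.mpr z.ne_zero
  have hsin : Real.cos θ = z.im / ‖(z : ℂ)‖ := by
    rw [← UpperHalfPlane.coe_im, ← Complex.sin_arg, harg, add_comm, Real.sin_add_pi_div_two]
    rcases hε with rfl | rfl <;> simp
  apply UpperHalfPlane.infDist_imaginaryAxis
  · apply Real.log_nonneg
    rw [one_le_div hc]
    linarith [Real.cos_le_one θ]
  · rw [Real.cosh_log (by positivity), ← inv_div z.im, ← hsin]
    field_simp
    linear_combination hsc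

theorem Real.one_add_sin_div_cos_le_exp_iff {θ ω : ℝ} (h0 : 0 ≤ θ) (h1 : θ < π / 2) :
    (1 + Real.sin θ) / Real.cos θ ≤ Real.exp ω ↔
      θ ≤ 2 * Real.arctan ((Real.exp ω - 1) / (Real.exp ω + 1)) := by
  have hc : 0 < Real.cos (θ / 2) := Real.cos_pos_of_mem_Ioo ⟨by linarith, by linarith⟩
  have hs : 0 ≤ Real.sin (θ / 2) := Real.sin_nonneg_of_nonneg_of_le_pi (by linarith) (by linarith)
  have hsc := Real.sin_sq_add_cos_sq (θ / 2)
  have hcθ : 0 < Real.cos θ := Real.cos_pos_of_mem_Ioo ⟨by linarith, h1⟩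
  have e1 : Real.sin θ = 2 * Real.sin (θ / 2) * Real.cos (θ / 2) := by
    rw [← Real.sin_two_mul]; ring_nf
  have e2 : Real.cos θ = Real.cos (θ / 2) ^ 2 - Real.sin (θ / 2) ^ 2 := by
    rw [← Real.cos_two_mul']; ring_nf
  have harctan : θ / 2 = Real.arctan (Real.tan (θ / 2)) :=
    (Real.arctan_tan (by linarith) (by linarith)).symm
  have hE := Real.exp_pos ω
  have hR : θ ≤ 2 * Real.arctan ((Real.exp ω - 1) / (Real.exp ω + 1)) ↔
      Real.tan (θ / 2) ≤ (Real.exp ω - 1) / (Real.exp ω + 1) := by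
    rw [← Real.arctan_le_arctan_iff (x := Real.tan (θ / 2)), ← harctan, div_le_iff₀' two_pos]
  have hfac : 1 + Real.sin θ = (Real.cos (θ / 2) + Real.sin (θ / 2)) ^ 2 := by
    rw [e1]; linear_combination -hsc
  rw [hR, Real.tan_eq_sin_div_cos, div_le_div_iff₀ hc (by positivity), div_le_iff₀ hcθ, hfac, e2,
    sq_sub_sq, sq, mul_left_comm, mul_le_mul_iff_right₀ (by positivity)]
  constructor <;> intro h <;> linarith

/-- In the hyperbolic upper half-plane, let `G` be the positive imaginary axis. For a point `z`
with `arg z = π/2 + ε θ`, `ε = ±1`, `0 ≤ θ < π/2`, the infimum of hyperbolic distances from `z`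
to `G` equals `log ((1 + sin θ)/cos θ)`. Consequently, for `ω ≥ 0`, the set of points at
distance `≤ ω` from `G` is the Euclidean sector of half-angle
`θ(ω) = 2 arctan ((e^ω - 1)/(e^ω + 1))` around the imaginary axis. -/
theorem stmt7 :
    ∀ G : Set UpperHalfPlane, G = {w : UpperHalfPlane | (w : ℂ).re = 0} →
    (∀ (z : UpperHalfPlane) (ε θ : ℝ), (ε = 1 ∨ ε = -1) → 0 ≤ θ → θ < π / 2 →
      Complex.arg (z : ℂ) = π / 2 + ε * θ →
      Metric.infDist z G = Real.log ((1 + Real.sin θ) / Real.cos θ)) ∧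
    (∀ ω : ℝ, 0 ≤ ω →
      {z : UpperHalfPlane | Metric.infDist z G ≤ ω} =
        {z : UpperHalfPlane |
          π / 2 - 2 * Real.arctan ((Real.exp ω - 1) / (Real.exp ω + 1)) ≤
            Complex.arg (z : ℂ) ∧
          Complex.arg (z : ℂ) ≤
            π / 2 + 2 * Real.arctan ((Real.exp ω - 1) / (Real.exp ω + 1))}) := by
  rintro G rfl
  refine ⟨fun z ε θ hε h0 h1 harg =>
    UpperHalfPlane.infDist_imaginaryAxis_of_arg hε h0 h1 harg, fun ω _ => ?_⟩
  ext z
  simp only [Set.mem_ofPred_eq]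
  have hpos : 0 < Complex.arg (z : ℂ) := by
    refine lt_of_le_of_ne (Complex.arg_nonneg_iff.mpr z.im_pos.le) fun h => ?_
    exact z.im_pos.ne' (Complex.arg_eq_zero_iff.mp h.symm).2
  have hlt : Complex.arg (z : ℂ) < π :=
    Complex.arg_lt_pi_iff.mpr (Or.inr z.im_pos.ne')
  obtain ⟨ε, hε, harg⟩ : ∃ ε : ℝ, (ε = 1 ∨ ε = -1) ∧
      Complex.arg (z : ℂ) = π / 2 + ε * |Complex.arg (z : ℂ) - π / 2| := by
    rcases abs_choice (Complex.arg (z : ℂ) - π / 2) with h | h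
    · exact ⟨1, Or.inl rfl, by rw [h]; ring⟩
    · exact ⟨-1, Or.inr rfl, by rw [h]; ring⟩
  have h1 : |Complex.arg (z : ℂ) - π / 2| < π / 2 :=
    abs_lt.mpr ⟨by linarith, by linarith⟩
  have h0 := abs_nonneg (Complex.arg (z : ℂ) - π / 2)
  have hc := Real.cos_pos_of_mem_Ioo ⟨by linarith, h1⟩
  have hs := Real.sin_nonneg_of_nonneg_of_le_pi h0 (by linarith)
  rw [UpperHalfPlane.infDist_imaginaryAxis_of_arg hε h0 h1 harg,
    Real.log_le_iff_le_exp (by positivity), Real.one_add_sin_div_cos_le_exp_iff h0 h1, abs_le]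
  constructor <;> rintro ⟨h, h'⟩ <;> constructor <;> linarith
end

section
/- Fix a base sequence (l⁰ᵢ, θ⁰ᵢ)_{i∈ℕ} of pairs of real numbers with l⁰ᵢ > 0 for all i. Let X be the set of all sequences (lᵢ, θᵢ)_{i∈ℕ} with lᵢ > 0 for all i such that sup_i max(|log(lᵢ/l⁰ᵢ)|, |lᵢθᵢ − l⁰ᵢθ⁰ᵢ|) < ∞, with distance d_FN(x, y) = sup_i max(|log(lᵢ/l'ᵢ)|, |lᵢθᵢ − l'ᵢθ'ᵢ|). Then (X, d_FN) is a complete metric space. -/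
open Real

/-- The Fenchel–Nielsen distance between two coordinate sequences `(lᵢ, θᵢ)` and
`(l'ᵢ, θ'ᵢ)`: `sup_i max (|log (lᵢ/l'ᵢ)|, |lᵢθᵢ - l'ᵢθ'ᵢ|)`. -/
noncomputable def dFN (x y : ℕ → ℝ × ℝ) : ℝ :=
  ⨆ i, max |Real.log ((x i).1 / (y i).1)| |(x i).1 * (x i).2 - (y i).1 * (y i).2|

/-- The Fenchel–Nielsen Teichmüller space based at the coordinate sequence `base`:
sequences `(lᵢ, θᵢ)` with `lᵢ > 0` at finite Fenchel–Nielsen distance from `base`. -/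
def FNSpace (base : ℕ → ℝ × ℝ) : Type :=
  {x : ℕ → ℝ × ℝ // (∀ i, 0 < (x i).1) ∧
    BddAbove (Set.range fun i =>
      max |Real.log ((x i).1 / (base i).1)|
        |(x i).1 * (x i).2 - (base i).1 * (base i).2|)}

open scoped BoundedContinuousFunction

/-- The logarithmic length and twist-displacement coordinates of `x` relative to `base`. -/
noncomputable def relativeCoords (base x : ℕ → ℝ × ℝ) (i : ℕ) : ℝ × ℝ :=
  (Real.log ((x i).1 / (base i).1), (x i).1 * (x i).2 - (base i).1 * (base i).2)

lemma dist_relativeCoords {base x y : ℕ → ℝ × ℝ} (hbase : ∀ i, 0 < (base i).1)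
    (hx : ∀ i, 0 < (x i).1) (hy : ∀ i, 0 < (y i).1) (i : ℕ) :
    dist (relativeCoords base x i) (relativeCoords base y i) =
      max |Real.log ((x i).1 / (y i).1)| |(x i).1 * (x i).2 - (y i).1 * (y i).2| := by
  rw [Prod.dist_eq, Real.dist_eq, Real.dist_eq]
  simp only [relativeCoords]
  rw [Real.log_div (hx i).ne' (hbase i).ne', Real.log_div (hy i).ne' (hbase i).ne',
    Real.log_div (hx i).ne' (hy i).ne', sub_sub_sub_cancel_right, sub_sub_sub_cancel_right]

/-- The coordinate sequence whose relative coordinates with respect to `base` are `f`. -/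
noncomputable def ofRelativeCoords (base f : ℕ → ℝ × ℝ) (i : ℕ) : ℝ × ℝ :=
  ((base i).1 * Real.exp (f i).1,
    ((f i).2 + (base i).1 * (base i).2) / ((base i).1 * Real.exp (f i).1))

lemma relativeCoords_ofRelativeCoords {base : ℕ → ℝ × ℝ} (hbase : ∀ i, 0 < (base i).1)
    (f : ℕ → ℝ × ℝ) : relativeCoords base (ofRelativeCoords base f) = f := by
  ext i
  · simp [relativeCoords, ofRelativeCoords, (hbase i).ne']
  · have h : (base i).1 * Real.exp (f i).1 ≠ 0 := (mul_pos (hbase i) (Real.exp_pos _)).ne'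
    simp only [relativeCoords, ofRelativeCoords]
    rw [mul_div_cancel₀ _ h, add_sub_cancel_right]

lemma ofRelativeCoords_relativeCoords {base x : ℕ → ℝ × ℝ} (hbase : ∀ i, 0 < (base i).1)
    (hx : ∀ i, 0 < (x i).1) : ofRelativeCoords base (relativeCoords base x) = x := by
  ext i : 1
  have h : (base i).1 * Real.exp (Real.log ((x i).1 / (base i).1)) = (x i).1 := by
    rw [Real.exp_log (div_pos (hx i) (hbase i)), mul_div_cancel₀ _ (hbase i).ne']
  simp only [relativeCoords, ofRelativeCoords, h, sub_add_cancel]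
  rw [mul_div_cancel_left₀ _ (hx i).ne']

/-- Relative coordinates identify the Fenchel–Nielsen space with the space of bounded
sequences in `ℝ × ℝ`. -/
noncomputable def FNSpace.equivBounded (base : ℕ → ℝ × ℝ) (hbase : ∀ i, 0 < (base i).1) :
    FNSpace base ≃ (ℕ →ᵇ ℝ × ℝ) where
  toFun x := BoundedContinuousFunction.ofNormedAddCommGroupDiscrete (relativeCoords base x.1)
    x.2.2.choose fun i => x.2.2.choose_spec ⟨i, rfl⟩
  invFun f := ⟨ofRelativeCoords base f, fun i => mul_pos (hbase i) (Real.exp_pos _), ‖f‖, by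
    rintro _ ⟨i, rfl⟩
    change ‖relativeCoords base (ofRelativeCoords base f) i‖ ≤ ‖f‖
    rw [relativeCoords_ofRelativeCoords hbase]
    exact f.norm_coe_le_norm i⟩
  left_inv x := Subtype.ext (ofRelativeCoords_relativeCoords hbase x.2.1)
  right_inv f := DFunLike.coe_injective (relativeCoords_ofRelativeCoords hbase f)

/-- The Fenchel–Nielsen Teichmüller space, equipped with the Fenchel–Nielsen distance,
is a complete metric space. -/
theorem stmt17 (base : ℕ → ℝ × ℝ) (hbase : ∀ i, 0 < (base i).1) :
    ∃ m : MetricSpace (FNSpace base),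
      (∀ x y : FNSpace base, m.toDist.dist x y = dFN x.1 y.1) ∧
      @CompleteSpace (FNSpace base) m.toUniformSpace := by
  let e := FNSpace.equivBounded base hbase
  let m : MetricSpace (FNSpace base) := MetricSpace.induced e e.injective inferInstance
  refine ⟨m, fun x y => ?_, ?_⟩
  · change dist (e x) (e y) = _
    rw [BoundedContinuousFunction.dist_eq_iSup]
    exact iSup_congr (dist_relativeCoords hbase x.2.1 y.2.1)
  · have he : Isometry e := Isometry.of_dist_eq fun _ _ => rfl
    exact (he.isUniformInducing.completeSpace_congr e.surjective).2 inferInstance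
end
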